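/- arXiv:2010.09770 — 3 statements merged into one kernel-verified Lean document; each statement's English description precedes it below -/
import Mathlib

section
/- In a multi-layer network of Bernoulli logistic units, for every layer l ∈ {1,…,L} and every weight entry W^l_{ij}, the gradient of the expected reward satisfies ∂J(W)/∂W^l_{ij} = (1/2) E[R(X,A) (H^l_j − E[H^l_j | H^{l−1}]) H^{l−1}_i | π_W], where E[H^l_j | H^{l−1}] = 2σ((H^{l−1}W^l)_j) − 1; i.e., the per-unit REINFORCE update with global reward is an unbiased gradient estimator. -/
/-- The logistic sigmoid `σ(z) = 1/(1+exp(−z))`. -/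
noncomputable def sig (z : ℝ) : ℝ := 1 / (1 + Real.exp (-z))

/-- `σ'(z) = σ(z)(1−σ(z))`. -/
noncomputable def sigp (z : ℝ) : ℝ := sig z * (1 - sig z)

/-- The values of all layers of a multi-layer network with `L = n+1` layers (besides the
input layer): layer `0` is the state `x`, and layer `t+1` is the hidden/output value
`g t ∈ {−1,+1}^{m (t+1)}`. -/
def Vof (n : ℕ) (m : ℕ → ℕ) (x : Fin (m 0) → ℝ)
    (g : (t : Fin (n + 1)) → Fin (m (t.1 + 1)) → ℝ) : (l : ℕ) → Fin (m l) → ℝ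
  | 0 => x
  | (t + 1) => if ht : t < n + 1 then g ⟨t, ht⟩ else fun _ => 1

/-- All assignments of values in `{−1,+1}` to the units of layers `1, …, n+1`. -/
noncomputable def hiddenSet (n : ℕ) (m : ℕ → ℕ) :
    Finset ((t : Fin (n + 1)) → Fin (m (t.1 + 1)) → ℝ) :=
  Fintype.piFinset fun _ => Fintype.piFinset fun _ => ({-1, 1} : Finset ℝ)

/-- Probability `∏_{l=1}^{L} π_l(H^{l−1}, H^l; W^l)` of the layer values `g` given the
state `x`, where `π_l(h^{l−1},h^l;W^l) = ∏_i σ(h^l_i · (h^{l−1}W^l)_i)`. -/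
noncomputable def Pg (n : ℕ) (m : ℕ → ℕ)
    (W : (t : ℕ) → Matrix (Fin (m t)) (Fin (m (t + 1))) ℝ)
    (x : Fin (m 0) → ℝ) (g : (t : Fin (n + 1)) → Fin (m (t.1 + 1)) → ℝ) : ℝ :=
  ∏ t : Fin (n + 1), ∏ i,
    sig (Vof n m x g (t.1 + 1) i * ∑ j, Vof n m x g t.1 j * W t.1 j i)

/-- The expected reward `J(W) = E[R(X,A) | π_W]` of the multi-layer network. -/
noncomputable def Jnet (n : ℕ) (m : ℕ → ℕ)
    (W : (t : ℕ) → Matrix (Fin (m t)) (Fin (m (t + 1))) ℝ)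
    (X : Finset (Fin (m 0) → ℝ)) (d0 : (Fin (m 0) → ℝ) → ℝ)
    (R : (Fin (m 0) → ℝ) → (Fin (m (n + 1)) → ℝ) → ℝ) : ℝ :=
  ∑ x ∈ X, ∑ g ∈ hiddenSet n m, d0 x * Pg n m W x g * R x (Vof n m x g (n + 1))

/-- The matrix `W^t` with its `(i,j)` entry replaced by `s`. -/
def updEntry {a b : Type*} [DecidableEq a] [DecidableEq b]
    (M : Matrix a b ℝ) (i : a) (j : b) (s : ℝ) : Matrix a b ℝ :=
  Matrix.of fun p q => if p = i ∧ q = j then s else M p q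

lemma hasDerivAt_prod_log {ι : Type*} [DecidableEq ι] (s : Finset ι) (f : ι → ℝ → ℝ) (c : ι → ℝ)
    (x : ℝ) (h : ∀ a ∈ s, HasDerivAt (f a) (f a x * c a) x) :
    HasDerivAt (fun y => ∏ a ∈ s, f a y) ((∏ a ∈ s, f a x) * ∑ a ∈ s, c a) x := by
  induction s using Finset.induction_on with
  | empty => simpa using hasDerivAt_const x (1 : ℝ)
  | insert a s ha ih =>
    have h1 := h a (Finset.mem_insert_self a s)
    have h2 := ih (fun b hb => h b (Finset.mem_insert_of_mem hb))
    simp only [Finset.prod_insert ha, Finset.sum_insert ha]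
    exact (h1.fun_mul h2).congr_deriv (by ring)

lemma sig_hasDerivAt (z : ℝ) : HasDerivAt sig (sig z * (1 - sig z)) z := by
  have hpos : (1 + Real.exp (-z)) ≠ 0 := by positivity
  have h := (((hasDerivAt_neg z).exp).const_add 1).inv hpos
  have he : sig = (fun y => 1 + Real.exp (-y))⁻¹ := by
    funext y; simp [sig]
  have h' : HasDerivAt sig _ z := he ▸ h
  refine h'.congr_deriv ?_
  unfold sig
  field_simp
  ring

lemma sig_neg (z : ℝ) : sig (-z) = 1 - sig z := by
  unfold sig
  have h1 : (1 + Real.exp (-z)) ≠ 0 := by positivity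
  have h2 : (1 + Real.exp z) ≠ 0 := by positivity
  have h3 : Real.exp z * Real.exp (-z) = 1 := by rw [← Real.exp_add]; simp
  rw [neg_neg]
  field_simp
  linarith

lemma sig_factor (h z : ℝ) (hh : h = -1 ∨ h = 1) :
    sig (h * z) * (1 - sig (h * z)) * h = sig (h * z) * (1 / 2 * (h - (2 * sig z - 1))) := by
  rcases hh with rfl | rfl
  · rw [neg_one_mul, sig_neg]; ring
  · rw [one_mul]; ring

lemma Pg_hasDerivAt (n : ℕ) (m : ℕ → ℕ)
    (W : (t : ℕ) → Matrix (Fin (m t)) (Fin (m (t + 1))) ℝ)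
    (x : Fin (m 0) → ℝ) (g : (t : Fin (n + 1)) → Fin (m (t.1 + 1)) → ℝ)
    (hg : g ∈ hiddenSet n m)
    (t : ℕ) (ht : t < n + 1) (i : Fin (m t)) (j : Fin (m (t + 1))) :
    HasDerivAt (fun s => Pg n m (Function.update W t (updEntry (W t) i j s)) x g)
      (Pg n m W x g * (1 / 2 *
        (Vof n m x g (t + 1) j - (2 * sig (∑ k, Vof n m x g t k * W t k j) - 1)) *
              Vof n m x g t i)) (W t i j) := by
  have hV : Vof n m x g (t + 1) j = -1 ∨ Vof n m x g (t + 1) j = 1 := by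
    simp only [hiddenSet, Fintype.mem_piFinset, Finset.mem_insert, Finset.mem_singleton] at hg
    simpa [Vof, ht] using hg ⟨t, ht⟩ j
  have hW : Function.update W t (updEntry (W t) i j (W t i j)) = W := by
    have : updEntry (W t) i j (W t i j) = W t := by
      ext p q
      simp only [updEntry, Matrix.of_apply]
      split_ifs with h
      · rw [h.1, h.2]
      · rfl
    rw [this, Function.update_eq_self]
  set c := 1 / 2 * (Vof n m x g (t + 1) j - (2 * sig (∑ k, Vof n m x g t k * W t k j) - 1)) *
              Vof n m x g t i with hc
  unfold Pg
  have key := hasDerivAt_prod_log (Finset.univ : Finset (Fin (n + 1)))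
    (fun t' s => ∏ i', sig (Vof n m x g (t'.1 + 1) i' * ∑ j', Vof n m x g t'.1 j' *
      (Function.update W t (updEntry (W t) i j s)) t'.1 j' i'))
    (fun t' => if t' = ⟨t, ht⟩ then c else 0) (W t i j) ?_
  · simpa [hW] using key
  intro t' _
  by_cases htt : t' = ⟨t, ht⟩
  · subst htt
    have key2 := hasDerivAt_prod_log (Finset.univ : Finset (Fin (m (t + 1))))
      (fun i' s => sig (Vof n m x g (t + 1) i' * ∑ j', Vof n m x g t j' *
        (Function.update W t (updEntry (W t) i j s)) t j' i'))
      (fun i' => if i' = j then c else 0) (W t i j) ?_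
    · simpa using key2
    intro i' _
    by_cases hij : i' = j
    · subst hij
      have hlin : HasDerivAt (fun s => Vof n m x g (t + 1) i' * ∑ j', Vof n m x g t j' *
          (Function.update W t (updEntry (W t) i i' s)) t j' i')
          (Vof n m x g (t + 1) i' * ∑ j', Vof n m x g t j' * (if j' = i then 1 else 0))
          (W t i i') := by
        refine HasDerivAt.const_mul _ (HasDerivAt.fun_sum fun j' _ => HasDerivAt.const_mul _ ?_)
        simp only [Function.update_self, updEntry, Matrix.of_apply, and_true]
        split_ifs
        · exact hasDerivAt_id' _
        · exact hasDerivAt_const _ _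
      have h := (sig_hasDerivAt _).comp (W t i i') hlin
      refine h.congr_deriv ?_
      simp only [hW, if_true]
      have h3 := sig_factor (Vof n m x g (t + 1) i') (∑ k, Vof n m x g t k * W t k i') hV
      simp only [mul_ite, mul_one, mul_zero, Finset.sum_ite_eq', Finset.mem_univ, if_true]
      rw [← mul_assoc, h3, hc]
      ring
    · simp only [hij, if_false, mul_zero, Function.update_self, updEntry, Matrix.of_apply, and_false]
      exact hasDerivAt_const _ _
  · have hne : t'.1 ≠ t := fun h => htt (Fin.ext h)
    simp only [htt, if_false, mul_zero, Function.update_of_ne hne]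
    exact hasDerivAt_const _ _

/-- Per-unit REINFORCE with global reward is an unbiased gradient estimator: for every
layer (transition `t` into layer `t+1`) and weight entry `(i,j)`,
`∂J/∂W^l_{ij} = (1/2) E[R (H^l_j − E[H^l_j|H^{l−1}]) H^{l−1}_i | π_W]`,
where `E[H^l_j|H^{l−1}] = 2σ((H^{l−1}W^l)_j) − 1`. -/
theorem stmt8 (n : ℕ) (m : ℕ → ℕ) (hmL : m (n + 1) = 1)
    (W : (t : ℕ) → Matrix (Fin (m t)) (Fin (m (t + 1))) ℝ)
    (X : Finset (Fin (m 0) → ℝ)) (d0 : (Fin (m 0) → ℝ) → ℝ)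
    (hd0 : ∀ x ∈ X, 0 ≤ d0 x) (hd0sum : ∑ x ∈ X, d0 x = 1)
    (R : (Fin (m 0) → ℝ) → (Fin (m (n + 1)) → ℝ) → ℝ)
    (hR : ∀ x a, -1 ≤ R x a ∧ R x a ≤ 1)
    (t : ℕ) (ht : t < n + 1) (i : Fin (m t)) (j : Fin (m (t + 1))) :
    deriv (fun s => Jnet n m (Function.update W t (updEntry (W t) i j s)) X d0 R) (W t i j)
      = (1 / 2 : ℝ) * ∑ x ∈ X, ∑ g ∈ hiddenSet n m,
          d0 x * Pg n m W x g * R x (Vof n m x g (n + 1)) *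
            ((Vof n m x g (t + 1) j - (2 * sig (∑ k, Vof n m x g t k * W t k j) - 1)) *
              Vof n m x g t i) := by
  have hJ : HasDerivAt
      (fun s => Jnet n m (Function.update W t (updEntry (W t) i j s)) X d0 R) _ (W t i j) :=
    HasDerivAt.fun_sum fun x _ => HasDerivAt.fun_sum fun g hg =>
      ((Pg_hasDerivAt n m W x g hg t ht i j).const_mul (d0 x)).mul_const
        (R x (Vof n m x g (n + 1)))
  rw [hJ.deriv, Finset.mul_sum]
  refine Finset.sum_congr rfl fun x _ => ?_
  rw [Finset.mul_sum]
  refine Finset.sum_congr rfl fun g _ => ?_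
  ring
end

section
/- (Lemma 1.) Under the Weight Maximization with REINFORCE update, for every l ∈ {1,…,L−1}, the update satisfies the closed form ΔW^l = 2·4^{L−l} · R(X,A) · A · (H^{l−1})ᵀ (D^l M^{l+1} M^{l+2} ⋯ M^L)ᵀ, where D^l is the m^l×m^l diagonal matrix with j-th diagonal entry σ(−H^l_j (H^{l−1}W^l)_j), and for each k, M^k ∈ ℝ^{m^{k−1}×m^k} has entries M^k_{ij} = W^k_{ij} σ(−H^k_j (H^{k−1}W^k)_j). -/
/-- The Weight Maximization with REINFORCE update for the transition `t` (from layer `t`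
into layer `t+1`), for the realization `V` of all layer values and reward `r`:
`ΔW^L = (H^{L−1})ᵀ R (A − E[A|H^{L−1}])`, and for hidden transitions
`ΔW^l = (H^{l−1})ᵀ (R^l ⊙ (H^l − E[H^l|H^{l−1}]))` with
`R^l = (2(ΔW^{l+1} ⊙ W^{l+1})𝟙)ᵀ`. Here the output transition is `t = n` (so `L = n+1`). -/
noncomputable def dW (n : ℕ) (m : ℕ → ℕ)
    (W : (t : ℕ) → Matrix (Fin (m t)) (Fin (m (t + 1))) ℝ)
    (V : (l : ℕ) → Fin (m l) → ℝ) (r : ℝ) (t : ℕ) :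
    Matrix (Fin (m t)) (Fin (m (t + 1))) ℝ :=
  if t = n then
    Matrix.of fun i j =>
      V t i * (r * (V (t + 1) j - (2 * sig (∑ k, V t k * W t k j) - 1)))
  else if ht : t < n then
    Matrix.of fun i j =>
      V t i * ((2 * ∑ k, dW n m W V r (t + 1) j k * W (t + 1) j k) *
        (V (t + 1) j - (2 * sig (∑ k, V t k * W t k j) - 1)))
  else 0
termination_by n - t
decreasing_by omega

/-- The matrix product `D^{t+1} M^{t+2} ⋯ M^{t+1+k}` (in layer indexing:
`D^l M^{l+1} ⋯ M^{l+k}` with `l = t+1`), where `D^l` is diagonal with entries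
`σ(−H^l_j (H^{l−1}W^l)_j)` and `M^s` has entries `W^s_{ij} σ(−H^s_j (H^{s−1}W^s)_j)`. -/
noncomputable def chainR (n : ℕ) (m : ℕ → ℕ)
    (W : (t : ℕ) → Matrix (Fin (m t)) (Fin (m (t + 1))) ℝ)
    (V : (l : ℕ) → Fin (m l) → ℝ) (t : ℕ) :
    (k : ℕ) → Matrix (Fin (m (t + 1))) (Fin (m (t + 1 + k))) ℝ
  | 0 => Matrix.of fun i j =>
      if i = j then sig (-(V (t + 1) i * ∑ p, V t p * W t p i)) else 0
  | (k + 1) => chainR n m W V t k *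
      Matrix.of (fun i j =>
        W (t + 1 + k) i j * sig (-(V (t + 1 + k + 1) j * ∑ p, V (t + 1 + k) p * W (t + 1 + k) p j)))

theorem sig_key (h z : ℝ) (hh : h = 1 ∨ h = -1) :
    h - (2 * sig z - 1) = 2 * h * sig (-(h * z)) := by
  have h1 : sig (-z) = 1 - sig z := by
    unfold sig
    have := Real.exp_pos z
    rw [neg_neg, Real.exp_neg]
    field_simp
    ring
  rcases hh with rfl | rfl
  · rw [one_mul, h1]; ring
  · have : -(-1 * z) = z := by ring
    rw [this]; ring

/-- `chainR` applied to a family of test vectors. -/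
noncomputable def chainT (n : ℕ) (m : ℕ → ℕ)
    (W : (t : ℕ) → Matrix (Fin (m t)) (Fin (m (t + 1))) ℝ)
    (V : (l : ℕ) → Fin (m l) → ℝ) (t k : ℕ) (f : (l : ℕ) → Fin (m l) → ℝ)
    (j : Fin (m (t + 1))) : ℝ :=
  ∑ c, chainR n m W V t k j c * f (t + 1 + k) c

theorem chainT_zero (n : ℕ) (m : ℕ → ℕ)
    (W : (t : ℕ) → Matrix (Fin (m t)) (Fin (m (t + 1))) ℝ)
    (V : (l : ℕ) → Fin (m l) → ℝ) (t : ℕ) (f : (l : ℕ) → Fin (m l) → ℝ)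
    (j : Fin (m (t + 1))) :
    chainT n m W V t 0 f j
      = sig (-(V (t + 1) j * ∑ p, V t p * W t p j)) * f (t + 1) j := by
  have h : ∀ c : Fin (m (t + 1)), chainR n m W V t 0 j c
      = if j = c then sig (-(V (t + 1) j * ∑ p, V t p * W t p j)) else 0 := fun c => rfl
  change ∑ c : Fin (m (t + 1)), chainR n m W V t 0 j c * f (t + 1) c = _
  simp only [h, ite_mul, zero_mul, Finset.sum_ite_eq, Finset.mem_univ, if_true]

theorem chainT_succ (n : ℕ) (m : ℕ → ℕ)
    (W : (t : ℕ) → Matrix (Fin (m t)) (Fin (m (t + 1))) ℝ)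
    (V : (l : ℕ) → Fin (m l) → ℝ) (t k : ℕ) (f : (l : ℕ) → Fin (m l) → ℝ)
    (j : Fin (m (t + 1))) :
    chainT n m W V t (k + 1) f j
      = chainT n m W V t k (fun l i => ∑ c, W l i c *
          sig (-(V (l + 1) c * ∑ p, V l p * W l p c)) * f (l + 1) c) j := by
  have h : ∀ c : Fin (m (t + 1 + k + 1)), chainR n m W V t (k + 1) j c
      = ∑ d, chainR n m W V t k j d * (W (t + 1 + k) d c *
        sig (-(V (t + 1 + k + 1) c * ∑ p, V (t + 1 + k) p * W (t + 1 + k) p c))) :=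
    fun c => rfl
  change ∑ c : Fin (m (t + 1 + k + 1)), chainR n m W V t (k + 1) j c * f (t + 1 + k + 1) c = _
  unfold chainT
  simp only [h, Finset.sum_mul, Finset.mul_sum]
  rw [Finset.sum_comm]
  refine Finset.sum_congr rfl fun d _ => Finset.sum_congr rfl fun c _ => ?_
  ring

theorem chainT_left (n : ℕ) (m : ℕ → ℕ)
    (W : (t : ℕ) → Matrix (Fin (m t)) (Fin (m (t + 1))) ℝ)
    (V : (l : ℕ) → Fin (m l) → ℝ) (t k : ℕ) (f : (l : ℕ) → Fin (m l) → ℝ)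
    (j : Fin (m (t + 1))) :
    chainT n m W V t (k + 1) f j
      = sig (-(V (t + 1) j * ∑ p, V t p * W t p j)) *
        ∑ q, W (t + 1) j q * chainT n m W V (t + 1) k f q := by
  induction k generalizing f with
  | zero =>
    rw [chainT_succ, chainT_zero]
    simp only [chainT_zero, mul_assoc]
  | succ k ih =>
    rw [chainT_succ, ih]
    simp only [chainT_succ n m W V (t + 1) k f]

theorem dW_closed (n : ℕ) (m : ℕ → ℕ)
    (W : (t : ℕ) → Matrix (Fin (m t)) (Fin (m (t + 1))) ℝ)
    (V : (l : ℕ) → Fin (m l) → ℝ)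
    (hV : ∀ l, 1 ≤ l → l ≤ n + 1 → ∀ i, V l i = 1 ∨ V l i = -1)
    (r A : ℝ) (hA : ∀ b, V (n + 1) b = A) (k : ℕ) :
    ∀ (t : ℕ) (_ : t + k = n) (i : Fin (m t)) (j : Fin (m (t + 1))),
    dW n m W V r t i j
      = 2 * 4 ^ k * r * A * (V t i * chainT n m W V t k (fun _ _ => 1) j) := by
  induction k with
  | zero =>
    intro t ht i j
    obtain rfl : t = n := ht
    rw [dW, if_pos rfl, chainT_zero, Matrix.of_apply,
      sig_key _ _ (hV (t + 1) (by omega) le_rfl j), hA j]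
    ring
  | succ k ih =>
    intro t ht i j
    rw [dW, if_neg (by omega), dif_pos (by omega), chainT_left, Matrix.of_apply,
      sig_key _ _ (hV (t + 1) (by omega) (by omega) j)]
    simp only [ih (t + 1) (by omega)]
    have hs : V (t + 1) j * V (t + 1) j = 1 := by
      rcases hV (t + 1) (by omega) (by omega) j with h | h <;> rw [h] <;> norm_num
    have hsum : ∑ q, 2 * 4 ^ k * r * A *
          (V (t + 1) j * chainT n m W V (t + 1) k (fun _ _ => 1) q) * W (t + 1) j q
        = 2 * 4 ^ k * r * A * V (t + 1) j *
          ∑ q, W (t + 1) j q * chainT n m W V (t + 1) k (fun _ _ => 1) q := by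
      rw [Finset.mul_sum]
      exact Finset.sum_congr rfl fun q _ => by ring
    rw [hsum]
    generalize (∑ q, W (t + 1) j q * chainT n m W V (t + 1) k (fun _ _ => 1) q) = S
    generalize sig (-(V (t + 1) j * ∑ p, V t p * W t p j)) = s
    linear_combination (8 * 4 ^ k * r * A * V t i * S * s) * hs

/-- Lemma 1: for every hidden transition `t < n` (layer `l = t+1 ∈ {1,…,L−1}`, `L = n+1`),
the Weight Maximization with REINFORCE update satisfies the closed form
`ΔW^l = 2·4^{L−l} R A (H^{l−1})ᵀ (D^l M^{l+1} ⋯ M^L)ᵀ` (entrywise; the sum over `c`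
ranges over the one-element column index set of `D^l M^{l+1} ⋯ M^L`, since `m^L = 1`,
and `A = V (n+1) a` is the action). -/
theorem stmt9 (n : ℕ) (m : ℕ → ℕ) (hmL : m (n + 1) = 1)
    (W : (t : ℕ) → Matrix (Fin (m t)) (Fin (m (t + 1))) ℝ)
    (V : (l : ℕ) → Fin (m l) → ℝ)
    (hV : ∀ l, 1 ≤ l → l ≤ n + 1 → ∀ i, V l i = 1 ∨ V l i = -1)
    (r : ℝ) (t : ℕ) (ht : t < n) (i : Fin (m t)) (j : Fin (m (t + 1)))
    (a : Fin (m (n + 1))) :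
    dW n m W V r t i j
      = 2 * 4 ^ (n - t) * r * V (n + 1) a *
          (V t i * ∑ c : Fin (m (t + 1 + (n - t))), chainR n m W V t (n - t) j c) := by
  have hA : ∀ b, V (n + 1) b = V (n + 1) a := by
    intro b
    have : b = a := by
      apply Fin.ext
      have h1 := b.2
      have h2 := a.2
      omega
    rw [this]
  have h := dW_closed n m W V hV r (V (n + 1) a) hA (n - t) t (by omega) i j
  simpa only [chainT, mul_one] using h
end

section
/- (Theorem 1, precise form.) For every l ∈ {1,…,L−1} and every B > 0, there exists a constant C > 0, depending only on B, the layer sizes m⁰,…,m^L, the finite state set 𝒳, the initial distribution d₀, and the reward function, such that for all weight matrices W¹,…,W^L with ‖W^k‖₂ ≤ B for k = l+1,…,L, the expected Weight Maximization with REINFORCE update satisfies ‖E[ΔW^l | π_W] − 2·4^{L−l} ∇_{W^l} J(W)‖ ≤ C · Σ_{k=l+1}^L ‖W^k‖₂²; i.e., the update approximately follows gradient ascent on the expected reward with error of order the squared norms of the upper-layer weights. -/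
/-- Squared Frobenius norm `‖M‖₂² = Σ_{ij} M_{ij}²` of a matrix. -/
noncomputable def frobSq {a b : Type*} [Fintype a] [Fintype b] (M : Matrix a b ℝ) : ℝ :=
  ∑ i, ∑ j, (M i j) ^ 2

/-- The expectation `E[ΔW^t | π_W]` of the Weight Maximization with REINFORCE update for
transition `t`, over the state `X ~ d₀` and the layer values sampled by the network. -/
noncomputable def expDW (n : ℕ) (m : ℕ → ℕ)
    (W : (t : ℕ) → Matrix (Fin (m t)) (Fin (m (t + 1))) ℝ)
    (X : Finset (Fin (m 0) → ℝ)) (d0 : (Fin (m 0) → ℝ) → ℝ)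
    (R : (Fin (m 0) → ℝ) → (Fin (m (n + 1)) → ℝ) → ℝ) (t : ℕ) :
    Matrix (Fin (m t)) (Fin (m (t + 1))) ℝ :=
  ∑ x ∈ X, ∑ g ∈ hiddenSet n m,
    (d0 x * Pg n m W x g) • dW n m W (Vof n m x g) (R x (Vof n m x g (n + 1))) t

/-- The gradient `∇_{W^t} J(W)` of the expected reward, as the matrix of partial
derivatives in the entries of `W^t`. -/
noncomputable def gradJ (n : ℕ) (m : ℕ → ℕ)
    (W : (t : ℕ) → Matrix (Fin (m t)) (Fin (m (t + 1))) ℝ)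
    (X : Finset (Fin (m 0) → ℝ)) (d0 : (Fin (m 0) → ℝ) → ℝ)
    (R : (Fin (m 0) → ℝ) → (Fin (m (n + 1)) → ℝ) → ℝ) (t : ℕ) :
    Matrix (Fin (m t)) (Fin (m (t + 1))) ℝ :=
  Matrix.of fun i j =>
    deriv (fun s => Jnet n m (Function.update W t (updEntry (W t) i j s)) X d0 R) (W t i j)


lemma sig_pos (z : ℝ) : 0 < sig z := by unfold sig; positivity

lemma sig_le_one (z : ℝ) : sig z ≤ 1 := by
  unfold sig
  rw [div_le_one (by positivity)]
  linarith [Real.exp_pos (-z)]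

lemma sig_zero : sig 0 = 1 / 2 := by unfold sig; norm_num

lemma sig_sub_half (y : ℝ) : |sig y - 1 / 2| ≤ |y| / 4 := by
  have h := Convex.norm_image_sub_le_of_norm_hasDerivWithin_le (f := sig)
    (f' := fun z => sig z * (1 - sig z)) (C := 1 / 4) (s := Set.univ) (x := 0) (y := y)
    (fun z _ => (sig_hasDerivAt z).hasDerivWithinAt) (fun z _ => by
      have h1 := sig_pos z
      have h2 := sig_le_one z
      rw [Real.norm_eq_abs, abs_of_nonneg (mul_nonneg h1.le (by linarith))]
      nlinarith [sq_nonneg (sig z - 1 / 2)]) convex_univ (Set.mem_univ _) (Set.mem_univ _)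
  rw [sig_zero, Real.norm_eq_abs, Real.norm_eq_abs, sub_zero] at h
  linarith

lemma sig_taylor (y : ℝ) : |sig y - 1 / 2 - y / 4| ≤ y ^ 2 := by
  have h := Convex.norm_image_sub_le_of_norm_hasDerivWithin_le (f := fun z => sig z - z / 4)
    (f' := fun z => sig z * (1 - sig z) - 1 / 4) (C := |y|) (s := Set.Icc (-|y|) |y|)
    (x := 0) (y := y)
    (fun z _ => ((sig_hasDerivAt z).sub ((hasDerivAt_id z).div_const 4)).hasDerivWithinAt)
    (fun z hz => by
      have h1 := sig_sub_half z
      have h2 : |z| ≤ |y| := abs_le.2 hz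
      have h3 := sig_pos z
      have h4 := sig_le_one z
      have h5 : |sig z - 1 / 2| ≤ 1 / 2 := abs_le.2 ⟨by linarith, by linarith⟩
      have h6 : sig z * (1 - sig z) - 1 / 4 = -((sig z - 1 / 2) * (sig z - 1 / 2)) := by ring
      rw [Real.norm_eq_abs, h6, abs_neg, abs_mul]
      nlinarith [abs_nonneg (sig z - 1 / 2), abs_nonneg z])
    (convex_Icc _ _) ⟨by simp, by simp⟩ ⟨neg_abs_le y, le_abs_self y⟩
  simp only [sig_zero, Real.norm_eq_abs, sub_zero, zero_div] at h
  rw [show sig y - 1 / 2 - y / 4 = sig y - y / 4 - 1 / 2 by ring, ← sq_abs]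
  nlinarith

lemma prod_sig_zero {ι : Type*} [DecidableEq ι] (s : Finset ι) (y : ι → ℝ) :
    |∏ u ∈ s, sig (y u) - (1 / 2) ^ s.card| ≤ ∑ u ∈ s, |y u| := by
  induction s using Finset.induction_on with
  | empty => simp
  | insert a s ha ih =>
    rw [Finset.prod_insert ha, Finset.sum_insert ha, Finset.card_insert_of_notMem ha]
    have hP0 : 0 ≤ ∏ u ∈ s, sig (y u) := Finset.prod_nonneg fun u _ => (sig_pos _).le
    have hP1 : ∏ u ∈ s, sig (y u) ≤ 1 :=
      Finset.prod_le_one (fun u _ => (sig_pos _).le) fun u _ => sig_le_one _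
    have h1 := sig_sub_half (y a)
    generalize ∏ u ∈ s, sig (y u) = P at *
    have e : sig (y a) * P - (1 / 2) ^ (s.card + 1)
        = (sig (y a) - 1 / 2) * P + 1 / 2 * (P - (1 / 2) ^ s.card) := by ring
    rw [e]
    refine (abs_add_le _ _).trans ?_
    rw [abs_mul, abs_mul, abs_of_nonneg hP0, abs_of_pos (by norm_num : (0:ℝ) < 1 / 2)]
    nlinarith [abs_nonneg (y a), abs_nonneg (sig (y a) - 1 / 2),
      abs_nonneg (P - (1 / 2) ^ s.card)]

lemma prod_sig_one {ι : Type*} [DecidableEq ι] (s : Finset ι) (y : ι → ℝ) :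
    |∏ u ∈ s, sig (y u) - (1 / 2) ^ s.card * (1 + 1 / 2 * ∑ u ∈ s, y u)|
      ≤ (∑ u ∈ s, |y u|) ^ 2 := by
  induction s using Finset.induction_on with
  | empty => simp
  | insert a s ha ih =>
    have h0 := prod_sig_zero s y
    rw [Finset.prod_insert ha, Finset.sum_insert ha, Finset.card_insert_of_notMem ha,
      Finset.sum_insert ha]
    have hP0 : 0 ≤ ∏ u ∈ s, sig (y u) := Finset.prod_nonneg fun u _ => (sig_pos _).le
    have hP1 : ∏ u ∈ s, sig (y u) ≤ 1 :=
      Finset.prod_le_one (fun u _ => (sig_pos _).le) fun u _ => sig_le_one _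
    have h1 := sig_taylor (y a)
    have hS : 0 ≤ ∑ u ∈ s, |y u| := Finset.sum_nonneg fun u _ => abs_nonneg _
    generalize ∏ u ∈ s, sig (y u) = P at *
    generalize ∑ u ∈ s, y u = Y at *
    generalize ∑ u ∈ s, |y u| = S at *
    have e : sig (y a) * P - (1 / 2) ^ (s.card + 1) * (1 + 1 / 2 * (y a + Y))
        = (sig (y a) - 1 / 2 - y a / 4) * P + (y a / 4) * (P - (1 / 2) ^ s.card)
          + 1 / 2 * (P - (1 / 2) ^ s.card * (1 + 1 / 2 * Y)) := by ring
    rw [e]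
    refine (abs_add_three _ _ _).trans ?_
    rw [abs_mul, abs_mul, abs_mul, abs_of_nonneg hP0, abs_of_pos (by norm_num : (0:ℝ) < 1 / 2)]
    have a1 : |sig (y a) - 1 / 2 - y a / 4| * P ≤ |y a| ^ 2 := by
      rw [sq_abs]
      nlinarith [abs_nonneg (sig (y a) - 1 / 2 - y a / 4)]
    have a2 : |y a / 4| * |P - (1 / 2) ^ s.card| ≤ |y a| / 4 * S := by
      rw [abs_div, abs_of_pos (by norm_num : (0:ℝ) < 4)]
      exact mul_le_mul_of_nonneg_left h0 (by positivity)
    nlinarith [mul_nonneg (abs_nonneg (y a)) hS, sq_nonneg S]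

/-- Units of the network. -/
abbrev Un (n : ℕ) (m : ℕ → ℕ) := Σ s : Fin (n + 1), Fin (m (s.1 + 1))

abbrev Hid (n : ℕ) (m : ℕ → ℕ) := (t : Fin (n + 1)) → Fin (m (t.1 + 1)) → ℝ

abbrev Wts (m : ℕ → ℕ) := (t : ℕ) → Matrix (Fin (m t)) (Fin (m (t + 1))) ℝ

noncomputable def yv {n : ℕ} {m : ℕ → ℕ} (W : Wts m) (x : Fin (m 0) → ℝ) (g : Hid n m)
    (u : Un n m) : ℝ :=
  Vof n m x g (u.1.1 + 1) u.2 * ∑ j, Vof n m x g u.1.1 j * W u.1.1 j u.2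

lemma Pg_eq {n : ℕ} {m : ℕ → ℕ} (W : Wts m) (x : Fin (m 0) → ℝ) (g : Hid n m) :
    Pg n m W x g = ∏ u : Un n m, sig (yv W x g u) := by
  rw [Fintype.prod_sigma]; rfl

noncomputable def lowS (n : ℕ) (m : ℕ → ℕ) (t : ℕ) : Finset (Un n m) :=
  Finset.univ.filter fun u => u.1.1 ≤ t

noncomputable def highS (n : ℕ) (m : ℕ → ℕ) (t : ℕ) : Finset (Un n m) :=
  Finset.univ.filter fun u => ¬ u.1.1 ≤ t

noncomputable def Alow {n : ℕ} {m : ℕ → ℕ} (t : ℕ) (W : Wts m) (x : Fin (m 0) → ℝ)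
    (g : Hid n m) : ℝ := ∏ u ∈ lowS n m t, sig (yv W x g u)

noncomputable def Qhigh {n : ℕ} {m : ℕ → ℕ} (t : ℕ) (W : Wts m) (x : Fin (m 0) → ℝ)
    (g : Hid n m) : ℝ := ∏ u ∈ highS n m t, sig (yv W x g u)

lemma Pg_split {n : ℕ} {m : ℕ → ℕ} (t : ℕ) (W : Wts m) (x : Fin (m 0) → ℝ) (g : Hid n m) :
    Pg n m W x g = Alow t W x g * Qhigh t W x g := by
  rw [Pg_eq]
  exact (Finset.prod_filter_mul_prod_filter_not _ _ _).symm

lemma prod_sig_bd {ι : Type*} (s : Finset ι) (y : ι → ℝ) :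
    |∏ u ∈ s, sig (y u)| ≤ 1 := by
  rw [abs_of_nonneg (Finset.prod_nonneg fun u _ => (sig_pos _).le)]
  exact Finset.prod_le_one (fun u _ => (sig_pos _).le) fun u _ => sig_le_one _

def flipU {n : ℕ} {m : ℕ → ℕ} (u : Un n m) (g : Hid n m) : Hid n m :=
  Function.update g u.1 (Function.update (g u.1) u.2 (-(g u.1 u.2)))

lemma mem_hid {n : ℕ} {m : ℕ → ℕ} {g : Hid n m} :
    g ∈ hiddenSet n m ↔ ∀ s i, g s i = -1 ∨ g s i = 1 := by
  simp [hiddenSet, Fintype.mem_piFinset]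

lemma flip_mem {n : ℕ} {m : ℕ → ℕ} (u : Un n m) {g : Hid n m} (hg : g ∈ hiddenSet n m) :
    flipU u g ∈ hiddenSet n m := by
  rw [mem_hid] at *
  obtain ⟨s0, i0⟩ := u
  intro s i
  unfold flipU
  by_cases hs : s = s0
  · subst hs
    simp only [Function.update_self]
    by_cases hi : i = i0
    · subst hi
      simp only [Function.update_self]
      rcases hg s i with h | h <;> simp [h]
    · rw [Function.update_of_ne hi]; exact hg s i
  · simp only [Function.update_of_ne hs]; exact hg s i

lemma flipU_flipU {n : ℕ} {m : ℕ → ℕ} (u : Un n m) (g : Hid n m) :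
    flipU u (flipU u g) = g := by
  unfold flipU; simp

lemma sum_flip_zero {n : ℕ} {m : ℕ → ℕ} (u : Un n m) (F : Hid n m → ℝ)
    (h : ∀ g ∈ hiddenSet n m, F (flipU u g) = - F g) : ∑ g ∈ hiddenSet n m, F g = 0 := by
  refine Finset.sum_involution (fun g _ => flipU u g) ?_ ?_ ?_ ?_
  · intro g hg; rw [h g hg]; ring
  · intro g hg hne he
    have := h g hg
    rw [he] at this
    apply hne; linarith
  · intro g hg; exact flip_mem u hg
  · intro g hg; exact flipU_flipU u g

lemma V_flip_layer {n : ℕ} {m : ℕ → ℕ} (x : Fin (m 0) → ℝ) (u : Un n m) (g : Hid n m) (l : ℕ)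
    (hl : l ≠ u.1.1 + 1) : Vof n m x (flipU u g) l = Vof n m x g l := by
  cases l with
  | zero => rfl
  | succ l =>
    simp only [Vof]
    split_ifs with h
    · unfold flipU
      rw [Function.update_of_ne]
      intro e
      apply hl
      rw [← e]
    · rfl

lemma V_flip_ne {n : ℕ} {m : ℕ → ℕ} (x : Fin (m 0) → ℝ) (u : Un n m) (g : Hid n m)
    (k : Fin (m (u.1.1 + 1))) (hk : k ≠ u.2) :
    Vof n m x (flipU u g) (u.1.1 + 1) k = Vof n m x g (u.1.1 + 1) k := by
  simp only [Vof, u.1.2, dif_pos]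
  simp only [flipU, Fin.eta, Function.update_self]
  rw [Function.update_of_ne hk]

lemma V_flip_self {n : ℕ} {m : ℕ → ℕ} (x : Fin (m 0) → ℝ) (u : Un n m) (g : Hid n m) :
    Vof n m x (flipU u g) (u.1.1 + 1) u.2 = - Vof n m x g (u.1.1 + 1) u.2 := by
  simp only [Vof, u.1.2, dif_pos]
  simp only [flipU, Fin.eta, Function.update_self]

lemma V_pm {n : ℕ} {m : ℕ → ℕ} (x : Fin (m 0) → ℝ) {g : Hid n m} (hg : g ∈ hiddenSet n m)
    (l : ℕ) (i : Fin (m (l + 1))) :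
    Vof n m x g (l + 1) i = -1 ∨ Vof n m x g (l + 1) i = 1 := by
  simp only [Vof]
  split_ifs with h
  · exact mem_hid.1 hg _ _
  · right; rfl

lemma V_abs {n : ℕ} {m : ℕ → ℕ} (x : Fin (m 0) → ℝ) {g : Hid n m} (hg : g ∈ hiddenSet n m)
    (l : ℕ) (hl : 1 ≤ l) (i : Fin (m l)) : |Vof n m x g l i| = 1 := by
  obtain ⟨l, rfl⟩ := Nat.exists_eq_add_of_le' hl
  rcases V_pm x hg l i with h | h <;> simp [h]

/-- `D_j = V_{t+1,j} - E[V_{t+1,j}|V_t]`. -/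
noncomputable def Dv {n : ℕ} {m : ℕ → ℕ} (W : Wts m) (x : Fin (m 0) → ℝ) (g : Hid n m)
    (t : ℕ) (j : Fin (m (t + 1))) : ℝ :=
  Vof n m x g (t + 1) j - (2 * sig (∑ k, Vof n m x g t k * W t k j) - 1)

lemma Dv_abs {n : ℕ} {m : ℕ → ℕ} (W : Wts m) (x : Fin (m 0) → ℝ) {g : Hid n m}
    (hg : g ∈ hiddenSet n m) (t : ℕ) (j : Fin (m (t + 1))) : |Dv W x g t j| ≤ 2 := by
  unfold Dv
  have h1 := sig_pos (∑ k, Vof n m x g t k * W t k j)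
  have h2 := sig_le_one (∑ k, Vof n m x g t k * W t k j)
  rw [abs_le]
  rcases V_pm x hg t j with h | h <;> rw [h] <;> constructor <;> linarith

lemma Alow_flip_high {n : ℕ} {m : ℕ → ℕ} (t : ℕ) (W : Wts m) (x : Fin (m 0) → ℝ)
    (g : Hid n m) (u : Un n m) (hu : t < u.1.1) :
    Alow t W x (flipU u g) = Alow t W x g := by
  unfold Alow
  refine Finset.prod_congr rfl fun v hv => ?_
  have hv' : v.1.1 ≤ t := by simpa [lowS] using hv
  unfold yv
  rw [V_flip_layer x u g _ (by omega), V_flip_layer x u g _ (by omega)]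

lemma Dv_flip_high {n : ℕ} {m : ℕ → ℕ} (t : ℕ) (W : Wts m) (x : Fin (m 0) → ℝ)
    (g : Hid n m) (u : Un n m) (hu : t < u.1.1) (j : Fin (m (t + 1))) :
    Dv W x (flipU u g) t j = Dv W x g t j := by
  unfold Dv
  rw [V_flip_layer x u g _ (by omega), V_flip_layer x u g _ (by omega)]

lemma AD_flip {n : ℕ} {m : ℕ → ℕ} (t : ℕ) (ht : t < n + 1) (W : Wts m) (x : Fin (m 0) → ℝ)
    (g : Hid n m) (hg : g ∈ hiddenSet n m) (j : Fin (m (t + 1))) :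
    Alow t W x (flipU ⟨⟨t, ht⟩, j⟩ g) * Dv W x (flipU ⟨⟨t, ht⟩, j⟩ g) t j
      = - (Alow t W x g * Dv W x g t j) := by
  set u : Un n m := ⟨⟨t, ht⟩, j⟩ with hu
  have hmem : u ∈ lowS n m t := by simp [lowS, hu]
  have hrest : ∏ v ∈ (lowS n m t).erase u, sig (yv W x (flipU u g) v)
      = ∏ v ∈ (lowS n m t).erase u, sig (yv W x g v) := by
    refine Finset.prod_congr rfl fun v hv => ?_
    obtain ⟨hne, hv⟩ := Finset.mem_erase.1 hv
    have hv' : v.1.1 ≤ t := by simpa [lowS] using hv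
    obtain ⟨⟨s, hs⟩, k⟩ := v
    simp only at hv'
    unfold yv
    simp only
    rw [V_flip_layer x u g s (by simp only [hu]; omega)]
    by_cases hst : s = t
    · subst hst
      rw [V_flip_ne x u g k (by
        intro e; apply hne; rw [hu, e])]
    · rw [V_flip_layer x u g (s + 1) (by simp only [hu]; omega)]
  unfold Alow
  rw [← Finset.mul_prod_erase _ _ hmem, ← Finset.mul_prod_erase _ (fun v => sig (yv W x g v)) hmem,
    hrest]
  have e1 : yv W x (flipU u g) u = - yv W x g u := by
    unfold yv
    rw [V_flip_self, V_flip_layer x u g u.1.1 (by omega)]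
    ring
  have e2 : Dv W x (flipU u g) t j
      = - Vof n m x g (t + 1) j - (2 * sig (∑ k, Vof n m x g t k * W t k j) - 1) := by
    unfold Dv
    rw [V_flip_layer x u g t (by simp only [hu]; omega)]
    have := V_flip_self x u g
    simp only [hu] at this ⊢
    rw [this]
  rw [e1, e2]
  unfold Dv yv
  simp only [hu]
  generalize ∏ v ∈ (lowS n m t).erase (⟨⟨t, ht⟩, j⟩ : Un n m), sig (Vof n m x g (v.1.1 + 1) v.2 * ∑ j, Vof n m x g v.1.1 j * W v.1.1 j v.2) = P
  generalize (∑ k, Vof n m x g t k * W t k j) = z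
  rcases V_pm x hg t j with h | h <;> rw [h] <;> simp only [neg_mul, one_mul, neg_neg, sig_neg] <;> ring

noncomputable def TT (n : ℕ) {m : ℕ → ℕ} (t : ℕ) (W : Wts m) : ℝ :=
  ∑ k ∈ Finset.Icc (t + 1) n, ∑ j, ∑ i, |W k j i|

lemma TT_nonneg (n : ℕ) {m : ℕ → ℕ} (t : ℕ) (W : Wts m) : 0 ≤ TT n t W :=
  Finset.sum_nonneg fun _ _ => Finset.sum_nonneg fun _ _ => Finset.sum_nonneg fun _ _ =>
    abs_nonneg _

lemma high_sum (n : ℕ) (m : ℕ → ℕ) (t : ℕ) (f : (k : ℕ) → Fin (m (k + 1)) → ℝ) :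
    ∑ u ∈ highS n m t, f u.1.1 u.2 = ∑ k ∈ Finset.Icc (t + 1) n, ∑ i, f k i := by
  unfold highS
  rw [Finset.sum_filter, Fintype.sum_sigma]
  have h1 : ∀ s : Fin (n + 1), (∑ i : Fin (m (s.1 + 1)),
      if ¬ s.1 ≤ t then f s.1 i else 0) = (fun k : ℕ => if ¬ k ≤ t then ∑ i, f k i else 0) s.1 := by
    intro s
    by_cases h : s.1 ≤ t <;> simp [h]
  rw [Finset.sum_congr rfl fun s _ => h1 s,
    Fin.sum_univ_eq_sum_range (fun k : ℕ => if ¬ k ≤ t then ∑ i, f k i else 0) (n + 1),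
    ← Finset.sum_filter]
  refine Finset.sum_congr ?_ fun _ _ => rfl
  ext k
  simp only [Finset.mem_filter, Finset.mem_range, Finset.mem_Icc]
  omega

lemma yv_sum {n : ℕ} {m : ℕ → ℕ} (t : ℕ) (W : Wts m) (x : Fin (m 0) → ℝ) {g : Hid n m}
    (hg : g ∈ hiddenSet n m) : ∑ u ∈ highS n m t, |yv W x g u| ≤ TT n t W := by
  have h1 : ∑ u ∈ highS n m t, |yv W x g u|
      ≤ ∑ u ∈ highS n m t, (fun (k : ℕ) (i : Fin (m (k + 1))) => ∑ j, |W k j i|) u.1.1 u.2 := by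
    refine Finset.sum_le_sum fun u hu => ?_
    have hu' : ¬ u.1.1 ≤ t := by simpa [highS] using hu
    unfold yv
    rw [abs_mul, V_abs x hg _ (by omega), one_mul]
    refine (Finset.abs_sum_le_sum_abs _ _).trans (le_of_eq ?_)
    refine Finset.sum_congr rfl fun j _ => ?_
    rw [abs_mul, V_abs x hg _ (by omega), one_mul]
  refine h1.trans (le_of_eq ?_)
  refine (high_sum n m t (fun (k : ℕ) (i : Fin (m (k + 1))) => ∑ j, |W k j i|)).trans ?_
  unfold TT
  exact Finset.sum_congr rfl fun k _ => Finset.sum_comm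

lemma row_le {n : ℕ} {m : ℕ → ℕ} {t : ℕ} (W : Wts m) {k : ℕ} (hk1 : t + 1 ≤ k) (hk2 : k ≤ n)
    (j : Fin (m k)) : ∑ i, |W k j i| ≤ TT n t W := by
  have h1 : ∑ i, |W k j i| ≤ ∑ j, ∑ i, |W k j i| :=
    Finset.single_le_sum (f := fun j => ∑ i, |W k j i|)
      (fun _ _ => Finset.sum_nonneg fun _ _ => abs_nonneg _) (Finset.mem_univ j)
  have h2 : ∑ j, ∑ i, |W k j i| ≤ TT n t W :=
    Finset.single_le_sum (f := fun k => ∑ j, ∑ i, |W k j i|)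
      (fun _ _ => Finset.sum_nonneg fun _ _ => Finset.sum_nonneg fun _ _ => abs_nonneg _)
      (Finset.mem_Icc.2 ⟨hk1, hk2⟩)
  exact h1.trans h2

lemma dW_last {n : ℕ} {m : ℕ → ℕ} (W : Wts m) (x : Fin (m 0) → ℝ) (g : Hid n m) (r : ℝ)
    (i : Fin (m n)) (j : Fin (m (n + 1))) :
    dW n m W (Vof n m x g) r n i j = Vof n m x g n i * (r * Dv W x g n j) := by
  rw [dW, if_pos rfl]
  rfl

lemma dW_step {n : ℕ} {m : ℕ → ℕ} (W : Wts m) (x : Fin (m 0) → ℝ) (g : Hid n m) (r : ℝ)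
    {t : ℕ} (ht : t < n) (i : Fin (m t)) (j : Fin (m (t + 1))) :
    dW n m W (Vof n m x g) r t i j = Vof n m x g t i *
      ((2 * ∑ k, dW n m W (Vof n m x g) r (t + 1) j k * W (t + 1) j k) * Dv W x g t j) := by
  rw [dW, if_neg ht.ne, dif_pos ht]
  rfl

lemma dW_step_bd {n : ℕ} {m : ℕ → ℕ} (W : Wts m) (x : Fin (m 0) → ℝ) {g : Hid n m}
    (hg : g ∈ hiddenSet n m) (r : ℝ) {t0 t : ℕ} (ht0 : t0 ≤ t)
    (ht : t < n) (M E : ℝ) (i : Fin (m t)) (hM : |Vof n m x g t i| ≤ M) (j : Fin (m (t + 1)))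
    (hE0 : 0 ≤ E) (hE : ∀ k, |dW n m W (Vof n m x g) r (t + 1) j k| ≤ E) :
    |dW n m W (Vof n m x g) r t i j| ≤ M * (E * (4 * TT n t0 W)) := by
  rw [dW_step W x g r ht, abs_mul, abs_mul, abs_mul, abs_two]
  have h1 : |∑ k, dW n m W (Vof n m x g) r (t + 1) j k * W (t + 1) j k| ≤ E * TT n t0 W := by
    refine (Finset.abs_sum_le_sum_abs _ _).trans ?_
    refine le_trans ?_ (mul_le_mul_of_nonneg_left
      (row_le W (by omega : t0 + 1 ≤ t + 1) (by omega : t + 1 ≤ n) j) hE0)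
    rw [Finset.mul_sum]
    refine Finset.sum_le_sum fun k _ => ?_
    rw [abs_mul]
    exact mul_le_mul_of_nonneg_right (hE k) (abs_nonneg _)
  have h2 := Dv_abs W x hg t j
  have h3 : 2 * |∑ k, dW n m W (Vof n m x g) r (t + 1) j k * W (t + 1) j k| * |Dv W x g t j|
      ≤ E * (4 * TT n t0 W) := by
    have hT := TT_nonneg n t0 W
    calc _ ≤ 2 * (E * TT n t0 W) * 2 := by gcongr
      _ = _ := by ring
  exact mul_le_mul hM h3 (by positivity) ((abs_nonneg _).trans hM)

lemma dW_bd {n : ℕ} {m : ℕ → ℕ} (W : Wts m) (x : Fin (m 0) → ℝ) {g : Hid n m}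
    (hg : g ∈ hiddenSet n m) (r : ℝ) (hr : |r| ≤ 1) (t0 : ℕ) (d : ℕ) :
    ∀ t, t0 + 1 ≤ t → t + d = n → ∀ (i : Fin (m t)) (j : Fin (m (t + 1))),
      |dW n m W (Vof n m x g) r t i j| ≤ 2 * (4 * TT n t0 W) ^ d := by
  induction d with
  | zero =>
    intro t h1 h2 i j
    obtain rfl : t = n := by omega
    rw [dW_last, abs_mul, abs_mul, V_abs x hg _ (by omega), pow_zero]
    nlinarith [Dv_abs W x hg t j, abs_nonneg r, abs_nonneg (Dv W x g t j)]
  | succ d ih =>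
    intro t h1 h2 i j
    have := dW_step_bd W x hg r (by omega : t0 ≤ t) (by omega : t < n) 1
      (2 * (4 * TT n t0 W) ^ d) i (V_abs x hg _ (by omega) i).le j
      (by have := TT_nonneg n t0 W; positivity) (fun k => ih (t + 1) (by omega) (by omega) j k)
    refine this.trans (le_of_eq ?_)
    ring

lemma sum_hid_bd {n : ℕ} {m : ℕ → ℕ} (F : Hid n m → ℝ) (E : ℝ)
    (h : ∀ g ∈ hiddenSet n m, |F g| ≤ E) :
    |∑ g ∈ hiddenSet n m, F g| ≤ (hiddenSet n m).card * E := by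
  refine (Finset.abs_sum_le_sum_abs _ _).trans ?_
  refine (Finset.sum_le_sum h).trans (le_of_eq ?_)
  rw [Finset.sum_const, nsmul_eq_mul]

/-- Lower-layer part of the integrand. -/
noncomputable def cc {n : ℕ} {m : ℕ → ℕ} (W : Wts m) (x : Fin (m 0) → ℝ)
    (R : (Fin (m 0) → ℝ) → (Fin (m (n + 1)) → ℝ) → ℝ) (t : ℕ) (i : Fin (m t))
    (j : Fin (m (t + 1))) (g : Hid n m) : ℝ :=
  Alow t W x g * Dv W x g t j * (Vof n m x g t i * R x (Vof n m x g (n + 1)))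

noncomputable def GG {n : ℕ} {m : ℕ → ℕ} (W : Wts m) (x : Fin (m 0) → ℝ)
    (R : (Fin (m 0) → ℝ) → (Fin (m (n + 1)) → ℝ) → ℝ) (t : ℕ) (i : Fin (m t))
    (j : Fin (m (t + 1))) : ℝ :=
  ∑ k, W (t + 1) j k * ∑ g ∈ hiddenSet n m,
    cc W x R t i j g * (Vof n m x g (t + 2) k * Vof n m x g (t + 1) j)

lemma cc_bd {n : ℕ} {m : ℕ → ℕ} (W : Wts m) (x : Fin (m 0) → ℝ)
    (R : (Fin (m 0) → ℝ) → (Fin (m (n + 1)) → ℝ) → ℝ) (hR : ∀ x a, |R x a| ≤ 1)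
    (t : ℕ) (i : Fin (m t)) (j : Fin (m (t + 1))) {g : Hid n m} (hg : g ∈ hiddenSet n m)
    (M : ℝ) (hM : |Vof n m x g t i| ≤ M) : |cc W x R t i j g| ≤ 2 * M := by
  unfold cc
  rw [abs_mul, abs_mul, abs_mul]
  have h1 : |Alow t W x g| ≤ 1 := prod_sig_bd _ _
  have h2 := Dv_abs W x hg t j
  have h3 := hR x (Vof n m x g (n + 1))
  calc _ ≤ 1 * 2 * (M * 1) := by
        have := (abs_nonneg _).trans hM
        gcongr
    _ = _ := by ring

lemma cc_flip {n : ℕ} {m : ℕ → ℕ} (W : Wts m) (x : Fin (m 0) → ℝ)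
    (R : (Fin (m 0) → ℝ) → (Fin (m (n + 1)) → ℝ) → ℝ) (t : ℕ) (ht : t < n) (i : Fin (m t))
    (j : Fin (m (t + 1))) (g : Hid n m) (hg : g ∈ hiddenSet n m) :
    cc W x R t i j (flipU ⟨⟨t, by omega⟩, j⟩ g) = - cc W x R t i j g := by
  unfold cc
  rw [AD_flip t _ W x g hg j, V_flip_layer x _ g t (by simp), V_flip_layer x _ g (n + 1)
    (by simp only; omega)]
  ring

lemma GG_zero {n : ℕ} {m : ℕ → ℕ} (W : Wts m) (x : Fin (m 0) → ℝ)
    (R : (Fin (m 0) → ℝ) → (Fin (m (n + 1)) → ℝ) → ℝ) (t : ℕ) (ht : t + 1 < n) (i : Fin (m t))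
    (j : Fin (m (t + 1))) : GG W x R t i j = 0 := by
  unfold GG
  refine Finset.sum_eq_zero fun k _ => ?_
  rw [sum_flip_zero (⟨⟨t + 1, by omega⟩, k⟩ : Un n m), mul_zero]
  intro g hg
  have h := V_flip_self x (⟨⟨t + 1, by omega⟩, k⟩ : Un n m) g
  simp only at h
  unfold cc
  rw [Alow_flip_high t W x g _ (by simp), Dv_flip_high t W x g _ (by simp),
    V_flip_layer x _ g t (by simp only; omega), V_flip_layer x _ g (n + 1) (by simp only; omega),
    V_flip_layer x _ g (t + 1) (by simp), h]
  ring

lemma lin_term {n : ℕ} {m : ℕ → ℕ} (W : Wts m) (x : Fin (m 0) → ℝ)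
    (R : (Fin (m 0) → ℝ) → (Fin (m (n + 1)) → ℝ) → ℝ) (t : ℕ) (ht : t < n) (i : Fin (m t))
    (j : Fin (m (t + 1))) :
    ∑ g ∈ hiddenSet n m, cc W x R t i j g * ∑ u ∈ highS n m t, yv W x g u = GG W x R t i j := by
  have h1 : ∀ g : Hid n m, cc W x R t i j g * ∑ u ∈ highS n m t, yv W x g u
      = ∑ k ∈ Finset.Icc (t + 1) n, ∑ i', ∑ j', W k j' i' *
        (cc W x R t i j g * (Vof n m x g (k + 1) i' * Vof n m x g k j')) := by
    intro g
    have := high_sum n m t (fun k i' => Vof n m x g (k + 1) i' * ∑ j', Vof n m x g k j' * W k j' i')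
    unfold yv
    rw [this, Finset.mul_sum]
    refine Finset.sum_congr rfl fun k _ => ?_
    rw [Finset.mul_sum]
    refine Finset.sum_congr rfl fun i' _ => ?_
    rw [Finset.mul_sum, Finset.mul_sum]
    refine Finset.sum_congr rfl fun j' _ => ?_
    ring
  have h2 : ∑ g ∈ hiddenSet n m, cc W x R t i j g * ∑ u ∈ highS n m t, yv W x g u
      = ∑ k ∈ Finset.Icc (t + 1) n, ∑ i', ∑ j', W k j' i' * ∑ g ∈ hiddenSet n m,
        (cc W x R t i j g * (Vof n m x g (k + 1) i' * Vof n m x g k j')) := by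
    rw [Finset.sum_congr rfl fun g _ => h1 g, Finset.sum_comm]
    refine Finset.sum_congr rfl fun k _ => ?_
    rw [Finset.sum_comm]
    refine Finset.sum_congr rfl fun i' _ => ?_
    rw [Finset.sum_comm]
    refine Finset.sum_congr rfl fun j' _ => ?_
    rw [Finset.mul_sum]
  rw [h2, Finset.sum_eq_single (t + 1)]
  · unfold GG
    refine Finset.sum_congr rfl fun k _ => ?_
    rw [Finset.sum_eq_single j]
    · intro j' _ hj'
      rw [sum_flip_zero (⟨⟨t, by omega⟩, j⟩ : Un n m), mul_zero]
      intro g hg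
      have h := V_flip_ne x (⟨⟨t, by omega⟩, j⟩ : Un n m) g j' hj'
      simp only at h
      rw [cc_flip W x R t ht i j g hg, h, V_flip_layer x _ g (t + 1 + 1) (by simp)]
      ring
    · intro h; exact absurd (Finset.mem_univ _) h
  · intro k hk hkt
    have hk' := Finset.mem_Icc.1 hk
    refine Finset.sum_eq_zero fun i' _ => Finset.sum_eq_zero fun j' _ => ?_
    rw [sum_flip_zero (⟨⟨t, by omega⟩, j⟩ : Un n m), mul_zero]
    intro g hg
    rw [cc_flip W x R t ht i j g hg, V_flip_layer x _ g (k + 1) (by simp only; omega),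
      V_flip_layer x _ g k (by simp only; omega)]
    ring
  · intro h
    exact absurd (Finset.mem_Icc.2 ⟨le_refl _, ht⟩) h

lemma grad_est {n : ℕ} {m : ℕ → ℕ} (W : Wts m) (x : Fin (m 0) → ℝ)
    (R : (Fin (m 0) → ℝ) → (Fin (m (n + 1)) → ℝ) → ℝ) (hR : ∀ x a, |R x a| ≤ 1)
    (t : ℕ) (ht : t < n) (i : Fin (m t)) (j : Fin (m (t + 1))) (M : ℝ) 
    (hM : ∀ g ∈ hiddenSet n m, |Vof n m x g t i| ≤ M) :
    |∑ g ∈ hiddenSet n m, Pg n m W x g *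
        (Vof n m x g t i * Dv W x g t j * R x (Vof n m x g (n + 1)))
      - 1 / 2 * ((1 / 2) ^ (highS n m t).card * GG W x R t i j)|
      ≤ (hiddenSet n m).card * (2 * M * TT n t W ^ 2) := by
  have hz : ∑ g ∈ hiddenSet n m, cc W x R t i j g = 0 :=
    sum_flip_zero _ _ fun g hg => cc_flip W x R t ht i j g hg
  have e : ∑ g ∈ hiddenSet n m, Pg n m W x g *
        (Vof n m x g t i * Dv W x g t j * R x (Vof n m x g (n + 1)))
      - 1 / 2 * ((1 / 2) ^ (highS n m t).card * GG W x R t i j)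
      = ∑ g ∈ hiddenSet n m, cc W x R t i j g * (Qhigh t W x g -
        (1 / 2) ^ (highS n m t).card * (1 + 1 / 2 * ∑ u ∈ highS n m t, yv W x g u)) := by
    have e1 : ∀ g : Hid n m, cc W x R t i j g * (Qhigh t W x g -
        (1 / 2) ^ (highS n m t).card * (1 + 1 / 2 * ∑ u ∈ highS n m t, yv W x g u))
        = Pg n m W x g * (Vof n m x g t i * Dv W x g t j * R x (Vof n m x g (n + 1)))
          - (1 / 2) ^ (highS n m t).card * cc W x R t i j g
          - 1 / 2 * (1 / 2) ^ (highS n m t).card *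
            (cc W x R t i j g * ∑ u ∈ highS n m t, yv W x g u) := by
      intro g
      rw [Pg_split t]
      unfold cc
      ring
    rw [Finset.sum_congr rfl fun g _ => e1 g, Finset.sum_sub_distrib, Finset.sum_sub_distrib,
      ← Finset.mul_sum, ← Finset.mul_sum, hz, lin_term W x R t ht]
    ring
  rw [e]
  refine sum_hid_bd _ _ fun g hg => ?_
  rw [abs_mul]
  have h1 := cc_bd W x R hR t i j hg M (hM g hg)
  have h2 := prod_sig_one (highS n m t) (yv W x g)
  have h3 := yv_sum t W x hg
  have h4 : 0 ≤ ∑ u ∈ highS n m t, |yv W x g u| := Finset.sum_nonneg fun _ _ => abs_nonneg _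
  refine mul_le_mul h1 (h2.trans ?_) (abs_nonneg _) ((abs_nonneg _).trans h1)
  gcongr

lemma dW_est {n : ℕ} {m : ℕ → ℕ} (W : Wts m) (x : Fin (m 0) → ℝ)
    (R : (Fin (m 0) → ℝ) → (Fin (m (n + 1)) → ℝ) → ℝ) (hR : ∀ x a, |R x a| ≤ 1)
    (t : ℕ) (ht : t + 1 = n) (i : Fin (m t)) (j : Fin (m (t + 1))) (M : ℝ) 
    (hM : ∀ g ∈ hiddenSet n m, |Vof n m x g t i| ≤ M) :
    |∑ g ∈ hiddenSet n m, Pg n m W x g *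
        dW n m W (Vof n m x g) (R x (Vof n m x g (n + 1))) t i j
      - 2 * ((1 / 2) ^ (highS n m t).card * GG W x R t i j)|
      ≤ (hiddenSet n m).card * (2 * M * (6 * TT n t W ^ 2)) := by
  have e : ∑ g ∈ hiddenSet n m, Pg n m W x g *
        dW n m W (Vof n m x g) (R x (Vof n m x g (n + 1))) t i j
      - 2 * ((1 / 2) ^ (highS n m t).card * GG W x R t i j)
      = ∑ g ∈ hiddenSet n m, cc W x R t i j g * (2 * ∑ k, W (t + 1) j k * (Vof n m x g (t + 1) j *
        (Qhigh t W x g * Dv W x g (t + 1) k -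
          (1 / 2) ^ (highS n m t).card * Vof n m x g (t + 2) k))) := by
    have e0 : 2 * ((1 / 2) ^ (highS n m t).card * GG W x R t i j) =
        ∑ g ∈ hiddenSet n m, ∑ k, 2 * (1 / 2) ^ (highS n m t).card * (W (t + 1) j k *
          (cc W x R t i j g * (Vof n m x g (t + 2) k * Vof n m x g (t + 1) j))) := by
      unfold GG
      rw [Finset.sum_comm, ← mul_assoc, Finset.mul_sum]
      refine Finset.sum_congr rfl fun k _ => ?_
      rw [Finset.mul_sum, Finset.mul_sum]
    rw [e0, ← Finset.sum_sub_distrib]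
    refine Finset.sum_congr rfl fun g _ => ?_
    rw [dW_step W x g _ (by omega : t < n)]
    subst ht
    simp only [dW_last]
    rw [Pg_split t]
    unfold cc
    simp only [Finset.mul_sum, Finset.sum_mul]
    rw [← Finset.sum_sub_distrib]
    refine Finset.sum_congr rfl fun k _ => ?_
    ring
  rw [e]
  have hT := TT_nonneg n t W
  refine sum_hid_bd _ _ fun g hg => ?_
  rw [abs_mul]
  have h1 := cc_bd W x R hR t i j hg M (hM g hg)
  refine mul_le_mul h1 ?_ (abs_nonneg _) ((abs_nonneg _).trans h1)
  rw [abs_mul, abs_two]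
  have h3 := yv_sum t W x hg
  have h2 := (prod_sig_zero (highS n m t) (yv W x g)).trans h3
  have h4 : ∀ k, |W (t + 1) j k * (Vof n m x g (t + 1) j * (Qhigh t W x g * Dv W x g (t + 1) k -
          (1 / 2) ^ (highS n m t).card * Vof n m x g (t + 2) k))|
      ≤ |W (t + 1) j k| * (3 * TT n t W) := by
    intro k
    rw [abs_mul, abs_mul, V_abs x hg _ (by omega), one_mul]
    refine mul_le_mul_of_nonneg_left ?_ (abs_nonneg _)
    have hz : |yv W x g ⟨⟨t + 1, by omega⟩, k⟩| ≤ TT n t W := by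
      refine le_trans ?_ h3
      exact Finset.single_le_sum (f := fun u => |yv W x g u|) (fun _ _ => abs_nonneg _)
        (by simp [highS])
    unfold yv at hz
    simp only at hz
    rw [abs_mul, V_abs x hg _ (by omega), one_mul] at hz
    have hs := sig_sub_half (∑ j, Vof n m x g (t + 1) j * W (t + 1) j k)
    have hv : |Vof n m x g (t + 2) k| = 1 := V_abs x hg _ (by omega) _
    have hQ : |Qhigh t W x g| ≤ 1 := prod_sig_bd _ _
    have h2' : |Qhigh t W x g - (1 / 2) ^ (highS n m t).card| ≤ TT n t W := h2
    unfold Dv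
    generalize (∑ j, Vof n m x g (t + 1) j * W (t + 1) j k) = z at *
    generalize Qhigh t W x g = Q at *
    generalize Vof n m x g (t + 2) k = v at *
    have e3 : Q * (v - (2 * sig z - 1)) - (1 / 2) ^ (highS n m t).card * v
        = (Q - (1 / 2) ^ (highS n m t).card) * v + (-2) * (Q * (sig z - 1 / 2)) := by ring
    rw [e3]
    refine (abs_add_le _ _).trans ?_
    rw [abs_mul, abs_mul, abs_mul, hv, abs_neg, abs_two]
    nlinarith [abs_nonneg Q, abs_nonneg (sig z - 1 / 2)]
  have h5 := row_le W (le_refl (t + 1)) (by omega : t + 1 ≤ n) j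
  have h6 := (Finset.abs_sum_le_sum_abs (fun k => W (t + 1) j k * (Vof n m x g (t + 1) j *
    (Qhigh t W x g * Dv W x g (t + 1) k -
          (1 / 2) ^ (highS n m t).card * Vof n m x g (t + 2) k))) Finset.univ).trans
    (Finset.sum_le_sum fun k _ => h4 k)
  rw [← Finset.sum_mul] at h6
  nlinarith

lemma upd_sum {a b : ℕ} (M : Matrix (Fin a) (Fin b) ℝ) (v : Fin a → ℝ) (i : Fin a) (j : Fin b)
    (s : ℝ) : ∑ k, v k * updEntry M i j s k j = ∑ k, v k * M k j + v i * (s - M i j) := by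
  have h : ∀ k, v k * updEntry M i j s k j
      = v k * M k j + (if k = i then v i * (s - M i j) else 0) := by
    intro k
    unfold updEntry
    by_cases hk : k = i
    · subst hk; simp; ring
    · simp [hk]
  rw [Finset.sum_congr rfl fun k _ => h k, Finset.sum_add_distrib]
  simp

lemma Pg_deriv {n : ℕ} {m : ℕ → ℕ} (W : Wts m) (x : Fin (m 0) → ℝ) (g : Hid n m)
    (hg : g ∈ hiddenSet n m) (t : ℕ) (ht : t < n) (i : Fin (m t)) (j : Fin (m (t + 1))) :
    HasDerivAt (fun s => Pg n m (Function.update W t (updEntry (W t) i j s)) x g)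
      (Pg n m W x g * (Vof n m x g t i * Dv W x g t j) / 2) (W t i j) := by
  set u : Un n m := ⟨⟨t, by omega⟩, j⟩ with hu
  have hmem : u ∈ (Finset.univ : Finset (Un n m)) := Finset.mem_univ _
  have hrest : ∀ s, ∏ v ∈ (Finset.univ : Finset (Un n m)).erase u,
      sig (yv (Function.update W t (updEntry (W t) i j s)) x g v)
      = ∏ v ∈ (Finset.univ : Finset (Un n m)).erase u, sig (yv W x g v) := by
    intro s
    refine Finset.prod_congr rfl fun v hv => ?_
    obtain ⟨hne, hv⟩ := Finset.mem_erase.1 hv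
    obtain ⟨⟨s', hs⟩, k⟩ := v
    unfold yv
    simp only
    by_cases hst : s' = t
    · subst hst
      have hk : k ≠ j := by
        intro e; apply hne; rw [hu, e]
      simp [updEntry, hk]
    · rw [Function.update_of_ne hst]
  have hfun : (fun s => Pg n m (Function.update W t (updEntry (W t) i j s)) x g)
      = fun s => sig (Vof n m x g (t + 1) j * (∑ k, Vof n m x g t k * W t k j
          + Vof n m x g t i * (s - W t i j)))
        * ∏ v ∈ (Finset.univ : Finset (Un n m)).erase u, sig (yv W x g v) := by
    funext s
    rw [Pg_eq, ← Finset.mul_prod_erase _ _ hmem, hrest]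
    change sig (Vof n m x g (t + 1) j * ∑ k, Vof n m x g t k *
      (Function.update W t (updEntry (W t) i j s)) t k j) * _ = _
    rw [Function.update_self, upd_sum]
  rw [hfun, Pg_eq, ← Finset.mul_prod_erase _ _ hmem]
  generalize ∏ v ∈ (Finset.univ : Finset (Un n m)).erase u, sig (yv W x g v) = P
  have hin : HasDerivAt (fun s => Vof n m x g (t + 1) j * (∑ k, Vof n m x g t k * W t k j
          + Vof n m x g t i * (s - W t i j))) (Vof n m x g (t + 1) j * Vof n m x g t i)
          (W t i j) := by
    have := ((((hasDerivAt_id (W t i j)).sub_const (W t i j)).const_mul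
      (Vof n m x g t i)).const_add (∑ k, Vof n m x g t k * W t k j)).const_mul
      (Vof n m x g (t + 1) j)
    simpa using this
  have h := ((sig_hasDerivAt _).comp _ hin).mul_const P
  refine h.congr_deriv ?_
  unfold yv Dv
  simp only [sub_self, mul_zero, add_zero]
  generalize (∑ k, Vof n m x g t k * W t k j) = z
  rcases V_pm x hg t j with h | h <;> rw [h] <;>
    simp only [neg_mul, one_mul, sig_neg] <;> ring

lemma gradJ_eq {n : ℕ} {m : ℕ → ℕ} (W : Wts m)
    (X : Finset (Fin (m 0) → ℝ)) (d0 : (Fin (m 0) → ℝ) → ℝ)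
    (R : (Fin (m 0) → ℝ) → (Fin (m (n + 1)) → ℝ) → ℝ) (t : ℕ) (ht : t < n)
    (i : Fin (m t)) (j : Fin (m (t + 1))) :
    gradJ n m W X d0 R t i j = ∑ x ∈ X, d0 x * (1 / 2 * ∑ g ∈ hiddenSet n m, Pg n m W x g *
        (Vof n m x g t i * Dv W x g t j * R x (Vof n m x g (n + 1)))) := by
  have h : HasDerivAt (fun s => Jnet n m (Function.update W t (updEntry (W t) i j s)) X d0 R)
      (∑ x ∈ X, ∑ g ∈ hiddenSet n m, d0 x * (Pg n m W x g *
        (Vof n m x g t i * Dv W x g t j) / 2) * R x (Vof n m x g (n + 1))) (W t i j) := by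
    unfold Jnet
    refine HasDerivAt.fun_sum fun x _ => HasDerivAt.fun_sum fun g hg => ?_
    exact ((Pg_deriv W x g hg t ht i j).const_mul _).mul_const _
  unfold gradJ
  rw [Matrix.of_apply, h.deriv]
  refine Finset.sum_congr rfl fun x _ => ?_
  rw [Finset.mul_sum, Finset.mul_sum]
  refine Finset.sum_congr rfl fun g _ => ?_
  ring

lemma expDW_eq {n : ℕ} {m : ℕ → ℕ} (W : Wts m)
    (X : Finset (Fin (m 0) → ℝ)) (d0 : (Fin (m 0) → ℝ) → ℝ)
    (R : (Fin (m 0) → ℝ) → (Fin (m (n + 1)) → ℝ) → ℝ) (t : ℕ)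
    (i : Fin (m t)) (j : Fin (m (t + 1))) :
    expDW n m W X d0 R t i j = ∑ x ∈ X, d0 x * ∑ g ∈ hiddenSet n m, Pg n m W x g *
        dW n m W (Vof n m x g) (R x (Vof n m x g (n + 1))) t i j := by
  unfold expDW
  rw [Matrix.sum_apply]
  refine Finset.sum_congr rfl fun x _ => ?_
  rw [Matrix.sum_apply, Finset.mul_sum]
  refine Finset.sum_congr rfl fun g _ => ?_
  rw [Matrix.smul_apply, smul_eq_mul]
  ring

lemma point_est {n : ℕ} {m : ℕ → ℕ} (W : Wts m) (x : Fin (m 0) → ℝ)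
    (R : (Fin (m 0) → ℝ) → (Fin (m (n + 1)) → ℝ) → ℝ) (hR : ∀ x a, |R x a| ≤ 1)
    (t : ℕ) (ht : t < n) (i : Fin (m t)) (j : Fin (m (t + 1))) (M τ : ℝ) (hM0 : 0 ≤ M)
    (hM : ∀ g ∈ hiddenSet n m, |Vof n m x g t i| ≤ M) (hτ : TT n t W ≤ τ) :
    |∑ g ∈ hiddenSet n m, Pg n m W x g *
        dW n m W (Vof n m x g) (R x (Vof n m x g (n + 1))) t i j
      - 4 ^ (n - t) * ∑ g ∈ hiddenSet n m, Pg n m W x g *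
        (Vof n m x g t i * Dv W x g t j * R x (Vof n m x g (n + 1)))|
      ≤ ((hiddenSet n m).card * M * (12 + 32 * (4 * τ) ^ (n - t - 2) + 2 * 4 ^ (n - t)))
        * TT n t W ^ 2 := by
  have hT := TT_nonneg n t W
  have hτ0 : 0 ≤ τ := hT.trans hτ
  have hg := grad_est W x R hR t ht i j M hM
  have h4 : (0:ℝ) < 4 ^ (n - t) := by positivity
  have hc : (0:ℝ) ≤ (hiddenSet n m).card := Nat.cast_nonneg _
  by_cases hn : t + 1 = n
  · have hd := dW_est W x R hR t hn i j M hM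
    have h41 : (4:ℝ) ^ (n - t) = 4 := by
      rw [show n - t = 1 by omega, pow_one]
    rw [h41]
    generalize (∑ g ∈ hiddenSet n m, Pg n m W x g *
        dW n m W (Vof n m x g) (R x (Vof n m x g (n + 1))) t i j) = a at *
    generalize ∑ g ∈ hiddenSet n m, Pg n m W x g *
        (Vof n m x g t i * Dv W x g t j * R x (Vof n m x g (n + 1))) = b at *
    generalize (1 / 2 : ℝ) ^ (highS n m t).card * GG W x R t i j = G at *
    have e : a - 4 * b = (a - 2 * G) - 4 * (b - 1 / 2 * G) := by ring
    have e2 := abs_sub (a - 2 * G) (4 * (b - 1 / 2 * G))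
    rw [abs_mul, abs_of_pos (by norm_num : (0:ℝ) < 4)] at e2
    rw [e]
    have h5 : 0 ≤ (hiddenSet n m).card * M * (32 * (4 * τ) ^ (n - t - 2)) * TT n t W ^ 2 := by
      positivity
    nlinarith
  · have hG : GG W x R t i j = 0 := GG_zero W x R t (by omega) i j
    rw [hG, mul_zero, mul_zero, sub_zero] at hg
    have hd : |∑ g ∈ hiddenSet n m, Pg n m W x g *
        dW n m W (Vof n m x g) (R x (Vof n m x g (n + 1))) t i j|
        ≤ (hiddenSet n m).card * (M * (32 * (4 * τ) ^ (n - t - 2) * TT n t W ^ 2)) := by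
      refine sum_hid_bd _ _ fun g hg => ?_
      rw [abs_mul]
      have hP : |Pg n m W x g| ≤ 1 := by rw [Pg_eq]; exact prod_sig_bd _ _
      have hb := dW_step_bd W x hg (R x (Vof n m x g (n + 1))) (le_refl t) ht M
        (2 * (4 * TT n t W) ^ (n - t - 1)) i (hM g hg) j (by positivity)
        (fun k => dW_bd W x hg _ (hR _ _) t (n - t - 1) (t + 1) le_rfl (by omega) j k)
      have h6 : 2 * (4 * TT n t W) ^ (n - t - 1) * (4 * TT n t W)
          ≤ 32 * (4 * τ) ^ (n - t - 2) * TT n t W ^ 2 := by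
        rw [show n - t - 1 = (n - t - 2) + 1 by omega, pow_succ]
        have : (4 * TT n t W) ^ (n - t - 2) ≤ (4 * τ) ^ (n - t - 2) := by gcongr
        nlinarith [sq_nonneg (TT n t W)]
      have h7 := hb.trans (mul_le_mul_of_nonneg_left h6 hM0)
      nlinarith [abs_nonneg (Pg n m W x g),
        abs_nonneg (dW n m W (Vof n m x g) (R x (Vof n m x g (n + 1))) t i j)]
    refine (abs_sub _ _).trans ?_
    rw [abs_mul, abs_of_pos h4]
    have h8 := mul_le_mul_of_nonneg_left hg h4.le
    have h5 : 0 ≤ (hiddenSet n m).card * M * 12 * TT n t W ^ 2 := by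
      positivity
    nlinarith

lemma frobSq_nonneg {a b : Type*} [Fintype a] [Fintype b] (M : Matrix a b ℝ) : 0 ≤ frobSq M :=
  Finset.sum_nonneg fun _ _ => Finset.sum_nonneg fun _ _ => sq_nonneg _

lemma sqrt_frob_le {a b : ℕ} (M : Matrix (Fin a) (Fin b) ℝ) (c : ℝ) (hc : 0 ≤ c)
    (h : ∀ i j, |M i j| ≤ c) : Real.sqrt (frobSq M) ≤ (a * b + 1) * c := by
  apply Real.sqrt_le_iff.2
  refine ⟨by positivity, ?_⟩
  have h1 : frobSq M ≤ a * (b * c ^ 2) := by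
    unfold frobSq
    have : ∀ i ∈ (Finset.univ : Finset (Fin a)), ∑ j, M i j ^ 2 ≤ b * c ^ 2 := by
      intro i _
      have : ∀ j ∈ (Finset.univ : Finset (Fin b)), M i j ^ 2 ≤ c ^ 2 := by
        intro j _
        exact sq_le_sq' (abs_le.1 (h i j)).1 (abs_le.1 (h i j)).2
      simpa using Finset.sum_le_sum this
    simpa using Finset.sum_le_sum this
  have h2 : (0:ℝ) ≤ a * b := by positivity
  nlinarith [sq_nonneg c, mul_nonneg h2 (sq_nonneg c), mul_nonneg (mul_nonneg h2 h2) (sq_nonneg c)]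

noncomputable def KK (n : ℕ) (m : ℕ → ℕ) (t : ℕ) : ℝ :=
  (Finset.Icc (t + 1) n).card * ∑ k ∈ Finset.Icc (t + 1) n, ((m k : ℝ) * m (k + 1))

lemma TT_sq (n : ℕ) {m : ℕ → ℕ} (t : ℕ) (W : Wts m) :
    TT n t W ^ 2 ≤ KK n m t * ∑ k ∈ Finset.Icc (t + 1) n, frobSq (W k) := by
  unfold TT KK
  refine sq_sum_le_card_mul_sum_sq.trans ?_
  rw [mul_assoc]
  refine mul_le_mul_of_nonneg_left ?_ (Nat.cast_nonneg _)
  rw [Finset.mul_sum]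
  refine Finset.sum_le_sum fun k hk => ?_
  have h1 : (∑ j, ∑ i, |W k j i|) ^ 2 ≤ (m k : ℝ) * m (k + 1) * frobSq (W k) := by
    refine sq_sum_le_card_mul_sum_sq.trans ?_
    rw [Finset.card_univ, Fintype.card_fin, mul_assoc]
    refine mul_le_mul_of_nonneg_left ?_ (Nat.cast_nonneg _)
    unfold frobSq
    rw [Finset.mul_sum]
    refine Finset.sum_le_sum fun j _ => ?_
    refine sq_sum_le_card_mul_sum_sq.trans ?_
    rw [Finset.card_univ, Fintype.card_fin]
    simp only [sq_abs]
    exact le_rfl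
  refine h1.trans (mul_le_mul_of_nonneg_right ?_ (frobSq_nonneg _))
  exact Finset.single_le_sum (f := fun k => (m k : ℝ) * m (k + 1)) (fun _ _ => by positivity) hk

lemma abs_factor (d a b c : ℝ) (hd : 0 ≤ d) :
    |d * a - 2 * c * (d * (1 / 2 * b))| = d * |a - c * b| := by
  rw [show d * a - 2 * c * (d * (1 / 2 * b)) = d * (a - c * b) by ring, abs_mul,
    abs_of_nonneg hd]

/-- Theorem 1 (precise form): for every hidden transition `t < n` (layer
`l = t+1 ∈ {1,…,L−1}`, `L = n+1`) and every `B > 0` there is a constant `C > 0`,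
depending only on `B`, the layer sizes, the state set, the initial distribution and the
reward function, such that whenever the upper-layer weights satisfy `‖W^k‖₂ ≤ B` for
`k = t+1, …, n`, the expected Weight Maximization with REINFORCE update satisfies
`‖E[ΔW^t | π_W] − 2·4^{L−l} ∇_{W^t} J(W)‖ ≤ C Σ_{k=t+1}^{n} ‖W^k‖₂²`. -/
theorem stmt11 (n : ℕ) (m : ℕ → ℕ) (hmL : m (n + 1) = 1)
    (X : Finset (Fin (m 0) → ℝ)) (d0 : (Fin (m 0) → ℝ) → ℝ)
    (hd0 : ∀ x ∈ X, 0 ≤ d0 x) (hd0sum : ∑ x ∈ X, d0 x = 1)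
    (R : (Fin (m 0) → ℝ) → (Fin (m (n + 1)) → ℝ) → ℝ)
    (hR : ∀ x a, -1 ≤ R x a ∧ R x a ≤ 1)
    (t : ℕ) (ht : t < n) (B : ℝ) (hB : 0 < B) :
    ∃ C > (0 : ℝ), ∀ W : (k : ℕ) → Matrix (Fin (m k)) (Fin (m (k + 1))) ℝ,
      (∀ k, t + 1 ≤ k → k ≤ n → Real.sqrt (frobSq (W k)) ≤ B) →
      Real.sqrt (frobSq
          (expDW n m W X d0 R t - (2 * 4 ^ (n - t) : ℝ) • gradJ n m W X d0 R t))
        ≤ C * ∑ k ∈ Finset.Icc (t + 1) n, frobSq (W k) := by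
  have hR' : ∀ x a, |R x a| ≤ 1 := fun x a => abs_le.2 (hR x a)
  set M : ℝ := 1 + ∑ x ∈ X, ∑ i, |x i| with hMdef
  have hM0 : 0 ≤ M := by positivity
  have hV : ∀ x ∈ X, ∀ (i : Fin (m t)), ∀ g ∈ hiddenSet n m, |Vof n m x g t i| ≤ M := by
    intro x hx i g hg
    have hs : 0 ≤ ∑ x ∈ X, ∑ i, |x i| := by positivity
    rcases Nat.eq_zero_or_pos t with h | h
    · subst h
      have h1 : |x i| ≤ ∑ i, |x i| :=
        Finset.single_le_sum (f := fun i => |x i|) (fun _ _ => abs_nonneg _) (Finset.mem_univ i)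
      have h2 : ∑ i, |x i| ≤ ∑ x ∈ X, ∑ i, |x i| :=
        Finset.single_le_sum (f := fun x : Fin (m 0) → ℝ => ∑ i, |x i|)
          (fun _ _ => Finset.sum_nonneg fun _ _ => abs_nonneg _) hx
      change |x i| ≤ M
      linarith
    · rw [V_abs x hg t h]
      linarith
  have hK : 0 ≤ KK n m t := by unfold KK; positivity
  set τ : ℝ := Real.sqrt (KK n m t * ((Finset.Icc (t + 1) n).card * B ^ 2)) with hτdef
  have hτ0 : 0 ≤ τ := Real.sqrt_nonneg _
  set C0 : ℝ := (hiddenSet n m).card * M *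
    (12 + 32 * (4 * τ) ^ (n - t - 2) + 2 * 4 ^ (n - t)) with hC0def
  have hC0 : 0 ≤ C0 := by positivity
  refine ⟨((m t : ℝ) * m (t + 1) + 1) * (C0 * KK n m t) + 1, by positivity, fun W hW => ?_⟩
  have hS0 : 0 ≤ ∑ k ∈ Finset.Icc (t + 1) n, frobSq (W k) :=
    Finset.sum_nonneg fun _ _ => frobSq_nonneg _
  have hSB : ∑ k ∈ Finset.Icc (t + 1) n, frobSq (W k) ≤ (Finset.Icc (t + 1) n).card * B ^ 2 := by
    have : ∀ k ∈ Finset.Icc (t + 1) n, frobSq (W k) ≤ B ^ 2 := by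
      intro k hk
      obtain ⟨h1, h2⟩ := Finset.mem_Icc.1 hk
      exact (Real.sqrt_le_left hB.le).1 (hW k h1 h2)
    refine (Finset.sum_le_sum this).trans (le_of_eq ?_)
    rw [Finset.sum_const, nsmul_eq_mul]
  have hTsq := TT_sq n t W
  have hTτ : TT n t W ≤ τ :=
    Real.le_sqrt_of_sq_le (hTsq.trans (mul_le_mul_of_nonneg_left hSB hK))
  have hentry : ∀ i j, |(expDW n m W X d0 R t
      - (2 * 4 ^ (n - t) : ℝ) • gradJ n m W X d0 R t) i j| ≤ C0 * TT n t W ^ 2 := by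
    intro i j
    rw [Matrix.sub_apply, Matrix.smul_apply, smul_eq_mul, gradJ_eq W X d0 R t ht, expDW_eq,
      Finset.mul_sum, ← Finset.sum_sub_distrib]
    refine (Finset.abs_sum_le_sum_abs _ _).trans ?_
    have : ∀ x ∈ X, _ ≤ d0 x * (C0 * TT n t W ^ 2) := fun x hx =>
      mul_le_mul_of_nonneg_left
        (point_est W x R hR' t ht i j M τ hM0 (hV x hx i) hTτ) (hd0 x hx)
    refine le_trans (Finset.sum_le_sum fun x hx => le_trans (le_of_eq ?_) (this x hx)) ?_
    · exact abs_factor _ _ _ _ (hd0 x hx)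
    · rw [← Finset.sum_mul, hd0sum, one_mul]
  refine (sqrt_frob_le _ _ (by positivity) hentry).trans ?_
  calc ((m t : ℝ) * m (t + 1) + 1) * (C0 * TT n t W ^ 2)
      ≤ ((m t : ℝ) * m (t + 1) + 1) * (C0 * (KK n m t *
          ∑ k ∈ Finset.Icc (t + 1) n, frobSq (W k))) := by gcongr
    _ ≤ _ := by
      rw [add_mul]
      linarith
end
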